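/- arXiv:gr-qc/9903034 — 6 statements merged into one kernel-verified Lean document; each statement's English description precedes it below -/
import Mathlib

section
/- Let $0 < a < b$ and let $p, \rho, n, T, \mu, \xi : (a,b) \to \mathbb{R}$ be differentiable functions with $T > 0$, $\xi > 0$ and $p + \rho > 0$ on $(a,b)$. Assume the equation of hydrostatic equilibrium $p' = -(p+\rho)\,\xi'/\xi$, the Gibbs–Duhem relation $(p/T)' = n\,(\mu/T)' - \rho\,(1/T)'$, and that $\mu/T$ is constant on $(a,b)$. Then the products $T\xi$ and $\mu\xi$ are constant on $(a,b)$ (the Tolman conditions). -/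
open Set

/-- **Tolman conditions.** For a static self-gravitating relativistic fluid in
hydrostatic equilibrium satisfying the Gibbs–Duhem relation and the condition of
vanishing heat flow and diffusion (`μ/T` constant), the products `T·ξ` and `μ·ξ`
are constant. -/
theorem tolman_conditions
    (a b : ℝ) (ha : 0 < a) (hab : a < b)
    (p ρ n T μ ξ : ℝ → ℝ)
    (hpd : ∀ x ∈ Ioo a b, DifferentiableAt ℝ p x)
    (hρd : ∀ x ∈ Ioo a b, DifferentiableAt ℝ ρ x)
    (hnd : ∀ x ∈ Ioo a b, DifferentiableAt ℝ n x)
    (hTd : ∀ x ∈ Ioo a b, DifferentiableAt ℝ T x)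
    (hμd : ∀ x ∈ Ioo a b, DifferentiableAt ℝ μ x)
    (hξd : ∀ x ∈ Ioo a b, DifferentiableAt ℝ ξ x)
    (hT : ∀ x ∈ Ioo a b, 0 < T x)
    (hξ : ∀ x ∈ Ioo a b, 0 < ξ x)
    (hpρ : ∀ x ∈ Ioo a b, 0 < p x + ρ x)
    -- equation of hydrostatic equilibrium: p' = -(p+ρ) ξ'/ξ
    (hhyd : ∀ x ∈ Ioo a b, deriv p x = -(p x + ρ x) * deriv ξ x / ξ x)
    -- Gibbs–Duhem relation: (p/T)' = n (μ/T)' - ρ (1/T)'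
    (hGD : ∀ x ∈ Ioo a b,
      deriv (fun y => p y / T y) x
        = n x * deriv (fun y => μ y / T y) x - ρ x * deriv (fun y => (T y)⁻¹) x)
    -- vanishing heat flow and diffusion: μ/T is constant
    (hμT : ∀ x ∈ Ioo a b, ∀ y ∈ Ioo a b, μ x / T x = μ y / T y) :
    (∀ x ∈ Ioo a b, ∀ y ∈ Ioo a b, T x * ξ x = T y * ξ y) ∧
    (∀ x ∈ Ioo a b, ∀ y ∈ Ioo a b, μ x * ξ x = μ y * ξ y) := by
  have hderiv : ∀ x ∈ Ioo a b, HasDerivAt (fun y => T y * ξ y) 0 x := by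
    intro x hx
    have hTx := (hT x hx).ne'
    have hξx := (hξ x hx).ne'
    have hconst : deriv (fun y => μ y / T y) x = 0 := by
      have heq : (fun y => μ y / T y) =ᶠ[nhds x] fun _ => μ x / T x := by
        filter_upwards [isOpen_Ioo.mem_nhds hx] with y hy
        exact hμT y hy x hx
      rw [heq.deriv_eq, deriv_const]
    have hgd := hGD x hx
    rw [hconst, ((hpd x hx).hasDerivAt.fun_div (hTd x hx).hasDerivAt hTx).deriv,
      ((hTd x hx).hasDerivAt.fun_inv hTx).deriv, hhyd x hx] at hgd
    field_simp at hgd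
    have hzero : deriv T x * ξ x + T x * deriv ξ x = 0 := by
      apply (mul_eq_zero.mp _).resolve_left (hpρ x hx).ne'
      linear_combination -hgd
    have hmul := (hTd x hx).hasDerivAt.fun_mul (hξd x hx).hasDerivAt
    rwa [hzero] at hmul
  have hTξ : ∀ x ∈ Ioo a b, ∀ y ∈ Ioo a b, T x * ξ x = T y * ξ y := fun x hx y hy =>
    isOpen_Ioo.is_const_of_deriv_eq_zero isPreconnected_Ioo
      (fun z hz => (hderiv z hz).differentiableAt.differentiableWithinAt)
      (fun z hz => (hderiv z hz).deriv) hx hy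
  refine ⟨hTξ, fun x hx y hy => ?_⟩
  calc μ x * ξ x = μ x / T x * (T x * ξ x) := by
        rw [← mul_assoc, div_mul_cancel₀ _ (hT x hx).ne']
    _ = μ y / T y * (T y * ξ y) := by rw [hμT x hx y hy, hTξ x hx y hy]
    _ = μ y * ξ y := by rw [← mul_assoc, div_mul_cancel₀ _ (hT y hy).ne']
end

section
/- Let $R > 0$, $T_0 > 0$, $N \in \mathbb{R}$, $\varepsilon > 0$. Suppose $M, \xi, p, \rho, n, T : [0,R] \times (-\varepsilon,\varepsilon) \to \mathbb{R}$ and $\mu_0 : (-\varepsilon,\varepsilon) \to \mathbb{R}$ are continuously differentiable (with the mixed derivatives needed below continuous), and that for every $s$: $M(0,s) = 0$; $r - 2M(r,s) > 0$ on $(0,R]$; $\partial M/\partial r = 4\pi r^2 \rho$; $T > 0$ and $T(r,s)\,\xi(r,s) = T_0$; the ratio $\mu(r,s)/T(r,s) = \mu_0(s)/T_0$ is independent of $r$; the Gibbs–Duhem relation in the variation parameter holds: $\partial_s(p/T) = n\,\partial_s(\mu/T) - \rho\,\partial_s(1/T)$; and the particle number constraint $\int_0^R 4\pi r^2 \lambda(r,s)\,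 n(r,s)\, dr = N$ holds for all $s$, where $\lambda = (1 - 2M/r)^{-1/2}$. Define the free energy $F(s) = M(R,s) - T_0 S(s)$ with $S(s) = \int_0^R 4\pi r^2 \lambda\, (p+\rho)/T\, dr - (\mu_0(s)/T_0) N$. Then the first variation of the free energy is $F'(0) = \bigl[1 - \lambda(R,0)\xi(R,0)\bigr]\,\partial_s M(R,s)\big|_{s=0} - \int_0^R \Bigl(4\pi r\,\xi\,(p+\rho)\,\lambda^3 - \partial_r(\lambda\xi)\Bigr)\,\partial_s M(r,s)\big|_{s=0}\, dr$, where all quantities in the integrand are evaluated at $s = 0$. -/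
open Set Real intervalIntegral

/-- The radial metric function `λ(r,s) = (1 - 2M(r,s)/r)^(-1/2)` of a one-parameter
family of static, spherically symmetric configurations with mass function `M`. -/
noncomputable def lamFn (M : ℝ → ℝ → ℝ) (r s : ℝ) : ℝ :=
  (Real.sqrt (1 - 2 * M r s / r))⁻¹

/-- A `C¹` function on a strip is differentiable in the second variable, with a jointly continuous
derivative. -/
theorem ContDiffOn.exists_hasDerivAt_snd {a b c d : ℝ} (hab : a < b)
    {f : ℝ → ℝ → ℝ}
    (hf : ContDiffOn ℝ 1 (fun x : ℝ × ℝ => f x.1 x.2) (Icc a b ×ˢ Ioo c d)) :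
    ∃ f' : ℝ → ℝ → ℝ, ContinuousOn (fun x : ℝ × ℝ => f' x.1 x.2) (Icc a b ×ˢ Ioo c d) ∧
      ∀ r ∈ Icc a b, ∀ s ∈ Ioo c d, HasDerivAt (f r) (f' r s) s := by
  have hu : UniqueDiffOn ℝ (Icc a b ×ˢ Ioo c d) :=
    (uniqueDiffOn_Icc hab).prod (uniqueDiffOn_Ioo c d)
  refine ⟨fun r s => fderivWithin ℝ (fun x : ℝ × ℝ => f x.1 x.2) (Icc a b ×ˢ Ioo c d) (r, s)
    (0, 1), (hf.continuousOn_fderivWithin hu le_rfl).clm_apply continuousOn_const, ?_⟩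
  intro r hr s hs
  have h1 := (hf.differentiableOn one_ne_zero (r, s) ⟨hr, hs⟩).hasFDerivWithinAt
  have h2 : HasDerivWithinAt (fun t : ℝ => (r, t)) (0, 1) (Ioo c d) s :=
    (hasDerivWithinAt_const s _ r).prodMk (hasDerivWithinAt_id s _)
  have h3 := h1.comp_hasDerivWithinAt s h2 (fun t ht => ⟨hr, ht⟩)
  exact h3.hasDerivAt (Ioo_mem_nhds hs.1 hs.2)

/-- Slices of a jointly continuous function on a product are continuous in the first variable. -/
theorem ContinuousOn.slice_fst {A B : Set ℝ} {f : ℝ → ℝ → ℝ}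
    (hf : ContinuousOn (fun x : ℝ × ℝ => f x.1 x.2) (A ×ˢ B)) {s : ℝ} (hs : s ∈ B) :
    ContinuousOn (fun r => f r s) A :=
  hf.comp (f := fun r => (r, s)) (by fun_prop) (fun _ hr => ⟨hr, hs⟩)

/-- Leibniz rule for a function on a strip whose derivative in the parameter is jointly
continuous. -/
theorem hasDerivAt_integral_of_continuousOn_strip {a b c d : ℝ} (hab : a ≤ b)
    {f f' : ℝ → ℝ → ℝ}
    (hf : ContinuousOn (fun x : ℝ × ℝ => f x.1 x.2) (Icc a b ×ˢ Ioo c d))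
    (hf' : ContinuousOn (fun x : ℝ × ℝ => f' x.1 x.2) (Icc a b ×ˢ Ioo c d))
    (h : ∀ r ∈ Icc a b, ∀ s ∈ Ioo c d, HasDerivAt (f r) (f' r s) s) {s₀ : ℝ}
    (hs₀ : s₀ ∈ Ioo c d) :
    HasDerivAt (fun s => ∫ r in a..b, f r s) (∫ r in a..b, f' r s₀) s₀ := by
  obtain ⟨c', hc, hc'⟩ := exists_between hs₀.1
  obtain ⟨d', hd', hd⟩ := exists_between hs₀.2
  have hsub : Icc c' d' ⊆ Ioo c d := fun x hx => ⟨hc.trans_le hx.1, hx.2.trans_lt hd⟩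
  obtain ⟨C, hC⟩ := (isCompact_Icc.prod isCompact_Icc).exists_bound_of_continuousOn
    (hf'.mono (prod_mono_right hsub))
  have hint : ∀ g : ℝ → ℝ → ℝ,
      ContinuousOn (fun x : ℝ × ℝ => g x.1 x.2) (Icc a b ×ˢ Ioo c d) → ∀ s ∈ Ioo c d,
      IntervalIntegrable (fun r => g r s) MeasureTheory.volume a b := fun g hg s hs =>
    (hg.slice_fst hs).intervalIntegrable_of_Icc hab
  have hmem : ∀ t ∈ uIoc a b, t ∈ Icc a b := fun t ht =>
    Ioc_subset_Icc_self (uIoc_of_le hab ▸ ht)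
  refine (intervalIntegral.hasDerivAt_integral_of_dominated_loc_of_deriv_le
    (F := fun s r => f r s) (F' := fun s r => f' r s) (bound := fun _ => C)
    (Icc_mem_nhds hc' hd') ?_ (hint f hf s₀ hs₀) ?_ ?_ intervalIntegrable_const ?_).2
  · filter_upwards [Ioo_mem_nhds hs₀.1 hs₀.2] with s hs
    exact (hint f hf s hs).aestronglyMeasurable_restrict_uIoc
  · exact (hint f' hf' s₀ hs₀).aestronglyMeasurable_restrict_uIoc
  · exact Filter.Eventually.of_forall fun t ht s hs => hC (t, s) ⟨hmem t ht, hs⟩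
  · exact Filter.Eventually.of_forall fun t ht s hs => h t (hmem t ht) s (hsub hs)

/-- The weighted radial mean `∫₀¹ 4πt² f(rt, s) dt`. -/
noncomputable def radialMean (f : ℝ → ℝ → ℝ) (r s : ℝ) : ℝ :=
  ∫ t in (0:ℝ)..1, 4 * π * t ^ 2 * f (r * t) s

theorem mul_mem_Icc_of_mem_Icc_one {R r t : ℝ} (hr : r ∈ Icc 0 R) (ht : t ∈ Icc (0:ℝ) 1) :
    r * t ∈ Icc 0 R :=
  ⟨mul_nonneg hr.1 ht.1, (mul_le_of_le_one_right hr.1 ht.2).trans hr.2⟩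

theorem continuousOn_radialMean {R : ℝ} {B : Set ℝ} {f : ℝ → ℝ → ℝ}
    (hf : ContinuousOn (fun x : ℝ × ℝ => f x.1 x.2) (Icc 0 R ×ˢ B)) :
    ContinuousOn (fun x : ℝ × ℝ => radialMean f x.1 x.2) (Icc 0 R ×ˢ B) := by
  rw [continuousOn_iff_continuous_domRestrict]
  have hproj : ∀ t : ℝ, (projIcc (0:ℝ) 1 zero_le_one t : ℝ) ∈ Icc (0:ℝ) 1 := fun t =>
    (projIcc (0:ℝ) 1 zero_le_one t).2
  have h1 : Continuous fun y : (Icc (0:ℝ) R ×ˢ B : Set (ℝ × ℝ)) × ℝ =>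
      4 * π * y.2 ^ 2 * f (y.1.1.1 * projIcc (0:ℝ) 1 zero_le_one y.2) y.1.1.2 := by
    refine Continuous.mul (by fun_prop) ?_
    refine hf.comp_continuous
      (f := fun y : (Icc (0:ℝ) R ×ˢ B : Set (ℝ × ℝ)) × ℝ =>
        (y.1.1.1 * (projIcc (0:ℝ) 1 zero_le_one y.2 : ℝ), y.1.1.2)) ?_ ?_
    · have := (continuous_projIcc (a := (0:ℝ)) (b := 1) (h := zero_le_one))
      fun_prop
    · exact fun y => ⟨mul_mem_Icc_of_mem_Icc_one y.1.2.1 (hproj y.2), y.1.2.2⟩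
  have h2 := intervalIntegral.continuous_parametric_intervalIntegral_of_continuous'
    (μ := MeasureTheory.volume)
    (f := fun (x : (Icc (0:ℝ) R ×ˢ B : Set (ℝ × ℝ))) (t : ℝ) =>
      4 * π * t ^ 2 * f (x.1.1 * projIcc (0:ℝ) 1 zero_le_one t) x.1.2) h1 0 1
  refine h2.congr fun x => ?_
  refine intervalIntegral.integral_congr fun t ht => ?_
  rw [uIcc_of_le zero_le_one] at ht
  simp only [projIcc_of_mem zero_le_one ht]

theorem hasDerivAt_radialMean {R c d : ℝ} {f f' : ℝ → ℝ → ℝ}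
    (hf : ContinuousOn (fun x : ℝ × ℝ => f x.1 x.2) (Icc 0 R ×ˢ Ioo c d))
    (hf' : ContinuousOn (fun x : ℝ × ℝ => f' x.1 x.2) (Icc 0 R ×ˢ Ioo c d))
    (h : ∀ r ∈ Icc 0 R, ∀ s ∈ Ioo c d, HasDerivAt (f r) (f' r s) s)
    {r s : ℝ} (hr : r ∈ Icc 0 R) (hs : s ∈ Ioo c d) :
    HasDerivAt (radialMean f r) (radialMean f' r s) s := by
  have hmaps : MapsTo (fun x : ℝ × ℝ => (r * x.1, x.2)) (Icc 0 1 ×ˢ Ioo c d)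
      (Icc 0 R ×ˢ Ioo c d) := fun x hx => ⟨mul_mem_Icc_of_mem_Icc_one hr hx.1, hx.2⟩
  have hcont : ∀ g : ℝ → ℝ → ℝ,
      ContinuousOn (fun x : ℝ × ℝ => g x.1 x.2) (Icc 0 R ×ˢ Ioo c d) →
      ContinuousOn (fun x : ℝ × ℝ => 4 * π * x.1 ^ 2 * g (r * x.1) x.2)
        (Icc 0 1 ×ˢ Ioo c d) := fun g hg =>
    ContinuousOn.mul (by fun_prop)
      (hg.comp (f := fun x : ℝ × ℝ => (r * x.1, x.2)) (by fun_prop) hmaps)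
  exact hasDerivAt_integral_of_continuousOn_strip (f := fun t s => 4 * π * t ^ 2 * f (r * t) s)
    (f' := fun t s => 4 * π * t ^ 2 * f' (r * t) s) zero_le_one (hcont f hf) (hcont f' hf')
    (fun t ht s hs => (h _ (mul_mem_Icc_of_mem_Icc_one hr ht) s hs).const_mul _) hs

theorem integral_eq_cube_mul_radialMean (f : ℝ → ℝ → ℝ) (r s : ℝ) :
    ∫ x in (0:ℝ)..r, 4 * π * x ^ 2 * f x s = r ^ 3 * radialMean f r s := by
  have h := intervalIntegral.mul_integral_comp_mul_left
    (f := fun x => 4 * π * x ^ 2 * f x s) (a := 0) (b := 1) r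
  rw [mul_zero, mul_one] at h
  rw [← h, radialMean, pow_succ', mul_assoc, ← intervalIntegral.integral_const_mul (r ^ 2)]
  congr 1
  refine intervalIntegral.integral_congr fun t _ => ?_
  ring

theorem hasDerivAt_cube_mul_radialMean {R s : ℝ} {f : ℝ → ℝ → ℝ}
    (hf : ContinuousOn (fun r => f r s) (Icc 0 R)) {r : ℝ} (hr : r ∈ Ioo 0 R) :
    HasDerivAt (fun r => r ^ 3 * radialMean f r s) (4 * π * r ^ 2 * f r s) r := by
  rw [← funext fun x => integral_eq_cube_mul_radialMean f x s]
  have hc : ContinuousOn (fun x => 4 * π * x ^ 2 * f x s) (Icc 0 R) :=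
    ContinuousOn.mul (by fun_prop) hf
  refine intervalIntegral.integral_hasDerivAt_right ?_ ?_ ?_
  · exact (hc.mono (Icc_subset_Icc_right hr.2.le)).intervalIntegrable_of_Icc hr.1.le
  · exact (hc.mono Ioo_subset_Icc_self).stronglyMeasurableAtFilter isOpen_Ioo r hr
  · exact hc.continuousAt (Icc_mem_nhds hr.1 hr.2)

/-- A mass function with `M(0) = 0` and `M' = 4πr²ρ` is `r³` times the radial mean of `ρ`. -/
theorem eq_cube_mul_radialMean {R s : ℝ} {M ρ : ℝ → ℝ → ℝ}
    (hM : ContDiffOn ℝ 1 (fun r => M r s) (Icc 0 R))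
    (hρ : ContinuousOn (fun r => ρ r s) (Icc 0 R)) (hM0 : M 0 s = 0)
    (hMr : ∀ r ∈ Ioo 0 R, deriv (fun r' => M r' s) r = 4 * π * r ^ 2 * ρ r s)
    {r : ℝ} (hr : r ∈ Icc 0 R) : M r s = r ^ 3 * radialMean ρ r s := by
  rw [← integral_eq_cube_mul_radialMean]
  have hsub : Icc 0 r ⊆ Icc 0 R := Icc_subset_Icc_right hr.2
  rw [intervalIntegral.integral_eq_sub_of_hasDerivAt_of_le hr.1 (f := fun r => M r s)
    (hM.continuousOn.mono hsub), hM0, sub_zero]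
  · intro x hx
    have hx' : x ∈ Ioo 0 R := ⟨hx.1, hx.2.trans_le hr.2⟩
    rw [← hMr x hx']
    exact ((hM.differentiableOn one_ne_zero).differentiableAt
      (Icc_mem_nhds hx'.1 hx'.2)).hasDerivAt
  · exact (ContinuousOn.mul (by fun_prop) (hρ.mono hsub)).intervalIntegrable_of_Icc hr.1

theorem HasDerivAt.inv_sqrt {w : ℝ → ℝ} {w' x : ℝ} (h : HasDerivAt w w' x) (hx : 0 < w x) :
    HasDerivAt (fun y => (√(w y))⁻¹) ((√(w x))⁻¹ ^ 3 * (-w' / 2)) x := by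
  refine ((h.sqrt hx.ne').inv (Real.sqrt_pos.2 hx).ne').congr_deriv ?_
  have := (Real.sqrt_pos.2 hx).ne'
  field_simp

/-- **First variation of the free energy.** For a one-parameter family of momentarily
static, spherically symmetric configurations with fixed particle number `N` and fixed
temperature at infinity `T₀`, satisfying the Tolman condition `Tξ = T₀`, constancy of
`μ/T` in `r`, and the Gibbs–Duhem relation in the variation parameter, the first
variation of the free energy `F = M - T₀S` is
`F'(0) = [1 - λ(R)ξ(R)] δM(R) - ∫₀ᴿ (4πr ξ (p+ρ) λ³ - (λξ)') δM dr`. -/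
theorem first_variation_free_energy
    (R T0 N ε : ℝ) (hR : 0 < R) (hT0 : 0 < T0) (hε : 0 < ε)
    (M ξ p ρ n T μ : ℝ → ℝ → ℝ) (μ0 : ℝ → ℝ)
    -- smoothness of the family (continuous differentiability, with the mixed
    -- derivatives needed continuous)
    (hMs : ContDiffOn ℝ 2 (fun x : ℝ × ℝ => M x.1 x.2) (Icc 0 R ×ˢ Ioo (-ε) ε))
    (hξs : ContDiffOn ℝ 1 (fun x : ℝ × ℝ => ξ x.1 x.2) (Icc 0 R ×ˢ Ioo (-ε) ε))
    (hps : ContDiffOn ℝ 1 (fun x : ℝ × ℝ => p x.1 x.2) (Icc 0 R ×ˢ Ioo (-ε) ε))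
    (hρs : ContDiffOn ℝ 1 (fun x : ℝ × ℝ => ρ x.1 x.2) (Icc 0 R ×ˢ Ioo (-ε) ε))
    (hns : ContDiffOn ℝ 1 (fun x : ℝ × ℝ => n x.1 x.2) (Icc 0 R ×ˢ Ioo (-ε) ε))
    (hTs : ContDiffOn ℝ 1 (fun x : ℝ × ℝ => T x.1 x.2) (Icc 0 R ×ˢ Ioo (-ε) ε))
    (hμs : ContDiffOn ℝ 1 (fun x : ℝ × ℝ => μ x.1 x.2) (Icc 0 R ×ˢ Ioo (-ε) ε))
    (hμ0s : ContDiffOn ℝ 1 μ0 (Ioo (-ε) ε))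
    -- M(0,s) = 0
    (hM0 : ∀ s ∈ Ioo (-ε) ε, M 0 s = 0)
    -- r - 2M > 0 on (0,R]
    (hhoriz : ∀ s ∈ Ioo (-ε) ε, ∀ r ∈ Ioc (0:ℝ) R, 0 < r - 2 * M r s)
    -- ∂M/∂r = 4π r² ρ
    (hMr : ∀ s ∈ Ioo (-ε) ε, ∀ r ∈ Icc (0:ℝ) R,
      deriv (fun r' => M r' s) r = 4 * π * r ^ 2 * ρ r s)
    -- T > 0 and the Tolman condition Tξ = T₀
    (hTpos : ∀ s ∈ Ioo (-ε) ε, ∀ r ∈ Icc (0:ℝ) R, 0 < T r s)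
    (hTol : ∀ s ∈ Ioo (-ε) ε, ∀ r ∈ Icc (0:ℝ) R, T r s * ξ r s = T0)
    -- μ/T = μ₀(s)/T₀ is independent of r
    (hμT : ∀ s ∈ Ioo (-ε) ε, ∀ r ∈ Icc (0:ℝ) R, μ r s / T r s = μ0 s / T0)
    -- Gibbs–Duhem relation in the variation parameter:
    -- ∂ₛ(p/T) = n ∂ₛ(μ/T) - ρ ∂ₛ(1/T)
    (hGD : ∀ s ∈ Ioo (-ε) ε, ∀ r ∈ Icc (0:ℝ) R,
      deriv (fun s' => p r s' / T r s') s
        = n r s * deriv (fun s' => μ r s' / T r s') s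
          - ρ r s * deriv (fun s' => (T r s')⁻¹) s)
    -- particle number constraint
    (hN : ∀ s ∈ Ioo (-ε) ε,
      (∫ r in (0:ℝ)..R, 4 * π * r ^ 2 * lamFn M r s * n r s) = N) :
    -- conclusion: the first variation of the free energy F = M - T₀ S
    deriv (fun s => M R s - T0 *
        ((∫ r in (0:ℝ)..R, 4 * π * r ^ 2 * lamFn M r s * (p r s + ρ r s) / T r s)
          - μ0 s / T0 * N)) 0
      = (1 - lamFn M R 0 * ξ R 0) * deriv (fun s => M R s) 0
        - ∫ r in (0:ℝ)..R,
            (4 * π * r * ξ r 0 * (p r 0 + ρ r 0) * (lamFn M r 0) ^ 3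
              - deriv (fun r' => lamFn M r' 0 * ξ r' 0) r)
            * deriv (fun s => M r s) 0 := by
  have h0 : (0:ℝ) ∈ Ioo (-ε) ε := ⟨neg_lt_zero.2 hε, hε⟩
  obtain ⟨ρ', hρ'c, hρ'⟩ := hρs.exists_hasDerivAt_snd hR
  obtain ⟨p', hp'c, hp'⟩ := hps.exists_hasDerivAt_snd hR
  obtain ⟨T', hT'c, hT'⟩ := hTs.exists_hasDerivAt_snd hR
  have hρc := hρs.continuousOn
  have hpc := hps.continuousOn
  have hTc := hTs.continuousOn
  have hM : ∀ s ∈ Ioo (-ε) ε, ∀ r ∈ Icc 0 R, M r s = r ^ 3 * radialMean ρ r s := by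
    intro s hs r hr
    refine eq_cube_mul_radialMean (R := R) ?_ (hρc.slice_fst hs) (hM0 s hs)
      (fun r hr => hMr s hs r (Ioo_subset_Icc_self hr)) hr
    exact (hMs.of_le one_le_two).comp (f := fun r => (r, s)) (by fun_prop)
      (fun r hr => ⟨hr, hs⟩)
  have hQc := continuousOn_radialMean hρc
  have hQ'c := continuousOn_radialMean hρ'c
  have hQ' : ∀ r ∈ Icc 0 R, ∀ s ∈ Ioo (-ε) ε,
      HasDerivAt (radialMean ρ r) (radialMean ρ' r s) s := fun r hr s hs =>
    hasDerivAt_radialMean hρc hρ'c hρ' hr hs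
  have hw : ∀ r ∈ Icc 0 R, ∀ s ∈ Ioo (-ε) ε,
      1 - 2 * M r s / r = 1 - 2 * r ^ 2 * radialMean ρ r s := by
    intro r hr s hs
    rw [hM s hs r hr]
    rcases eq_or_ne r 0 with rfl | h
    · simp
    · field_simp
  have hwpos : ∀ r ∈ Icc 0 R, ∀ s ∈ Ioo (-ε) ε,
      0 < 1 - 2 * r ^ 2 * radialMean ρ r s := by
    intro r hr s hs
    rcases hr.1.eq_or_lt with rfl | h
    · simp
    · rw [← hw r hr s hs, sub_pos, div_lt_one h]
      linarith [hhoriz s hs r ⟨h, hr.2⟩]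
  have hlam : ∀ r ∈ Icc 0 R, ∀ s ∈ Ioo (-ε) ε,
      lamFn M r s = (√(1 - 2 * r ^ 2 * radialMean ρ r s))⁻¹ := fun r hr s hs => by
    rw [lamFn, hw r hr s hs]
  have hlc : ContinuousOn (fun x : ℝ × ℝ => lamFn M x.1 x.2) (Icc 0 R ×ˢ Ioo (-ε) ε) := by
    refine ContinuousOn.congr (f := fun x : ℝ × ℝ =>
      (√(1 - 2 * x.1 ^ 2 * radialMean ρ x.1 x.2))⁻¹) ?_ fun x hx => hlam x.1 hx.1 x.2 hx.2
    refine ContinuousOn.inv₀ (ContinuousOn.sqrt ?_) fun x hx =>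
      (Real.sqrt_pos.2 (hwpos x.1 hx.1 x.2 hx.2)).ne'
    exact continuousOn_const.sub (ContinuousOn.mul (by fun_prop) hQc)
  have hl' : ∀ r ∈ Icc 0 R, ∀ s ∈ Ioo (-ε) ε,
      HasDerivAt (lamFn M r) (lamFn M r s ^ 3 * (r ^ 2 * radialMean ρ' r s)) s := by
    intro r hr s hs
    have h := (((hQ' r hr s hs).const_mul (2 * r ^ 2)).const_sub 1).inv_sqrt (hwpos r hr s hs)
    rw [← hlam r hr s hs] at h
    refine (h.congr_of_eventuallyEq ?_).congr_deriv (by ring)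
    filter_upwards [Ioo_mem_nhds hs.1 hs.2] with t ht using hlam r hr t ht
  have hTne : ∀ r ∈ Icc 0 R, ∀ s ∈ Ioo (-ε) ε, T r s ≠ 0 := fun r hr s hs =>
    (hTpos s hs r hr).ne'
  have hS := hasDerivAt_integral_of_continuousOn_strip hR.le (c := -ε) (d := ε)
    (f := fun r s => 4 * π * r ^ 2 * lamFn M r s * (p r s + ρ r s) / T r s)
    (f' := fun r s => ((4 * π * r ^ 2 * (lamFn M r s ^ 3 * (r ^ 2 * radialMean ρ' r s))
        * (p r s + ρ r s) + 4 * π * r ^ 2 * lamFn M r s * (p' r s + ρ' r s)) * T r s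
        - 4 * π * r ^ 2 * lamFn M r s * (p r s + ρ r s) * T' r s) / T r s ^ 2)
    (ContinuousOn.div (by fun_prop) hTc fun x hx => hTne x.1 hx.1 x.2 hx.2)
    (ContinuousOn.div (by fun_prop) (by fun_prop) fun x hx =>
      pow_ne_zero 2 (hTne x.1 hx.1 x.2 hx.2))
    (fun r hr s hs => (((hl' r hr s hs).const_mul _).mul
      ((hp' r hr s hs).add (hρ' r hr s hs))).div (hT' r hr s hs) (hTne r hr s hs)) h0
  have hμ0' : HasDerivAt μ0 (deriv μ0 0) 0 :=
    ((hμ0s.differentiableOn one_ne_zero).differentiableAt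
      (Ioo_mem_nhds h0.1 h0.2)).hasDerivAt
  have hδM : ∀ r ∈ Icc 0 R, HasDerivAt (fun s => M r s) (r ^ 3 * radialMean ρ' r 0) 0 := by
    intro r hr
    refine ((hQ' r hr 0 h0).const_mul (r ^ 3)).congr_of_eventuallyEq ?_
    filter_upwards [Ioo_mem_nhds h0.1 h0.2] with t ht using hM t ht r hr
  have hRmem : R ∈ Icc 0 R := right_mem_Icc.2 hR.le
  have hF := (hδM R hRmem).sub ((hS.sub ((hμ0'.div_const T0).mul_const N)).const_mul T0)
  refine hF.deriv.trans ?_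
  rw [(hδM R hRmem).deriv]
  have hQr : ContinuousOn (fun r => radialMean ρ r 0) (Icc 0 R) := hQc.slice_fst h0
  have hQ'r : ContinuousOn (fun r => radialMean ρ' r 0) (Icc 0 R) := hQ'c.slice_fst h0
  have hρr : ContinuousOn (fun r => ρ r 0) (Icc 0 R) := hρc.slice_fst h0
  have hρ'r : ContinuousOn (fun r => ρ' r 0) (Icc 0 R) := hρ'c.slice_fst h0
  have hpr : ContinuousOn (fun r => p r 0) (Icc 0 R) := hpc.slice_fst h0
  have hnr : ContinuousOn (fun r => n r 0) (Icc 0 R) := hns.continuousOn.slice_fst h0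
  have hlr : ContinuousOn (fun r => lamFn M r 0) (Icc 0 R) := hlc.slice_fst h0
  have hξ1 : ContDiffOn ℝ 1 (fun r => ξ r 0) (Icc 0 R) :=
    hξs.comp (f := fun r => (r, (0:ℝ))) (by fun_prop) (fun r hr => ⟨hr, h0⟩)
  have hξr := hξ1.continuousOn
  have hξ'r := hξ1.continuousOn_derivWithin (uniqueDiffOn_Icc hR) le_rfl
  set ξ' := derivWithin (fun r => ξ r 0) (Icc 0 R)
  have hξ' : ∀ r ∈ Ioo 0 R, HasDerivAt (fun r => ξ r 0) (ξ' r) r := fun r hr =>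
    (hξ1.differentiableOn one_ne_zero r (Ioo_subset_Icc_self hr)).hasDerivWithinAt.hasDerivAt
      (Icc_mem_nhds hr.1 hr.2)
  have hlr' : ∀ r ∈ Ioo 0 R, HasDerivAt (fun r => lamFn M r 0)
      (lamFn M r 0 ^ 3 * (4 * π * r * ρ r 0 - r * radialMean ρ r 0)) r := by
    intro r hr
    have hr0 : r ≠ 0 := hr.1.ne'
    have h1 := (((hasDerivAt_cube_mul_radialMean hρr hr).div (hasDerivAt_id r) hr0).const_mul
      2).const_sub 1
    have he : ∀ x : ℝ, x ≠ 0 → 1 - 2 * (x ^ 3 * radialMean ρ x 0 / x)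
        = 1 - 2 * x ^ 2 * radialMean ρ x 0 := fun x hx => by field_simp
    have h2 := h1.inv_sqrt (by
      simpa only [Pi.div_apply, id, he r hr0] using hwpos r (Ioo_subset_Icc_self hr) 0 h0)
    simp only [Pi.div_apply, id, he r hr0] at h2
    rw [← hlam r (Ioo_subset_Icc_self hr) 0 h0] at h2
    refine (h2.congr_of_eventuallyEq ?_).congr_deriv ?_
    · filter_upwards [Ioo_mem_nhds hr.1 hr.2] with x hx
      rw [hlam x (Ioo_subset_Icc_self hx) 0 h0, he x hx.1.ne']
    · field_simp
  set u' : ℝ → ℝ := fun r =>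
    lamFn M r 0 ^ 3 * (4 * π * r * ρ r 0 - r * radialMean ρ r 0) * ξ r 0
      + lamFn M r 0 * ξ' r
  have hu' : ∀ r ∈ Ioo 0 R, HasDerivAt (fun r => lamFn M r 0 * ξ r 0) (u' r) r :=
    fun r hr => (hlr' r hr).mul (hξ' r hr)
  have hu'c : ContinuousOn u' (Icc 0 R) := by fun_prop
  have hparts := intervalIntegral.integral_deriv_mul_eq_sub_of_hasDerivAt (a := 0) (b := R)
    (u := fun r => lamFn M r 0 * ξ r 0) (v := fun r => r ^ 3 * radialMean ρ' r 0) (u' := u')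
    (v' := fun r => 4 * π * r ^ 2 * ρ' r 0)
    (by rw [uIcc_of_le hR.le]; fun_prop) (by rw [uIcc_of_le hR.le]; fun_prop)
    (by rw [min_eq_left hR.le, max_eq_right hR.le]; exact hu')
    (by rw [min_eq_left hR.le, max_eq_right hR.le]
        exact fun r hr => hasDerivAt_cube_mul_radialMean hρ'r hr)
    (hu'c.intervalIntegrable_of_Icc hR.le)
    (ContinuousOn.intervalIntegrable_of_Icc hR.le (by fun_prop))
  have hrhs : ∫ r in (0:ℝ)..R,
      (4 * π * r * ξ r 0 * (p r 0 + ρ r 0) * (lamFn M r 0) ^ 3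
        - deriv (fun r' => lamFn M r' 0 * ξ r' 0) r) * deriv (fun s => M r s) 0
      = ∫ r in (0:ℝ)..R, (4 * π * r * ξ r 0 * (p r 0 + ρ r 0) * (lamFn M r 0) ^ 3 - u' r)
          * (r ^ 3 * radialMean ρ' r 0) := by
    refine intervalIntegral.integral_congr_uIoo fun r hr => ?_
    rw [uIoo_of_le hR.le] at hr
    simp only [(hu' r hr).deriv, (hδM r (Ioo_subset_Icc_self hr)).deriv]
  rw [hrhs]
  have hGD0 : ∀ r ∈ Icc 0 R, (p' r 0 * T r 0 - p r 0 * T' r 0) / T r 0 ^ 2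
      = n r 0 * (deriv μ0 0 / T0) - ρ r 0 * (-T' r 0 / T r 0 ^ 2) := by
    intro r hr
    have h1 := hGD 0 h0 r hr
    have h2 : HasDerivAt (fun s => μ r s / T r s) (deriv μ0 0 / T0) 0 := by
      refine (hμ0'.div_const T0).congr_of_eventuallyEq ?_
      filter_upwards [Ioo_mem_nhds h0.1 h0.2] with t ht using hμT t ht r hr
    have h3 := (hp' r hr 0 h0).div (hT' r hr 0 h0) (hTne r hr 0 h0)
    have h4 := (hT' r hr 0 h0).inv (hTne r hr 0 h0)
    rw [h2.deriv] at h1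
    exact h3.deriv.symm.trans (h1.trans (congrArg _ (congrArg _ h4.deriv)))
  have hkey : T0 * ∫ r in (0:ℝ)..R,
      ((4 * π * r ^ 2 * (lamFn M r 0 ^ 3 * (r ^ 2 * radialMean ρ' r 0))
        * (p r 0 + ρ r 0) + 4 * π * r ^ 2 * lamFn M r 0 * (p' r 0 + ρ' r 0)) * T r 0
        - 4 * π * r ^ 2 * lamFn M r 0 * (p r 0 + ρ r 0) * T' r 0) / T r 0 ^ 2
      = (∫ r in (0:ℝ)..R, (4 * π * r * ξ r 0 * (p r 0 + ρ r 0) * (lamFn M r 0) ^ 3 - u' r)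
          * (r ^ 3 * radialMean ρ' r 0))
        + deriv μ0 0 * (∫ r in (0:ℝ)..R, 4 * π * r ^ 2 * lamFn M r 0 * n r 0)
        + ∫ r in (0:ℝ)..R, (u' r * (r ^ 3 * radialMean ρ' r 0)
          + lamFn M r 0 * ξ r 0 * (4 * π * r ^ 2 * ρ' r 0)) := by
    rw [← intervalIntegral.integral_const_mul, ← intervalIntegral.integral_const_mul,
      ← intervalIntegral.integral_add, ← intervalIntegral.integral_add]
    · refine intervalIntegral.integral_congr fun r hr => ?_
      rw [uIcc_of_le hR.le] at hr
      have hT := hTne r hr 0 h0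
      have hξ : ξ r 0 = T0 / T r 0 := by
        rw [eq_div_iff hT, mul_comm, hTol 0 h0 r hr]
      have hg := hGD0 r hr
      have hp : p' r 0 = (n r 0 * (deriv μ0 0 / T0) * T r 0 ^ 2 + ρ r 0 * T' r 0
          + p r 0 * T' r 0) / T r 0 := by
        field_simp at hg ⊢
        linarith
      simp only [hξ, hp]
      field_simp
      ring
    all_goals exact ContinuousOn.intervalIntegrable_of_Icc hR.le (by fun_prop)
  rw [hN 0 h0, hparts] at hkey
  rw [mul_sub, hkey]
  field_simp
  ring
end

section
/- For parameters $m > 0$, $\alpha > 0$, $g > 0$, the Thomas–Fermi equation-of-state functions satisfy, for every $\psi > 0$, the identity $\psi\, p_F'(\psi) = -\bigl(p_F(\psi) + \rho_F(\psi)\bigr)$. (This is the consistency of the Fermi-gas equation of state with the equation of hydrostatic equilibrium and the Gibbs–Duhem relation.) -/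
open Set Real MeasureTheory

/-- The relativistic single-particle energy `E(q) = √(m² + q²)`. -/
noncomputable def fermiE (m q : ℝ) : ℝ := Real.sqrt (m ^ 2 + q ^ 2)

/-- The Fermi distribution factor `f(q,ψ) = (1 + exp(α(ψE(q) - m)/m))⁻¹`,
where `ψ` parametrizes the local temperature `T = m/(αψ)` and chemical
potential `μ = m/ψ`. -/
noncomputable def fermiF (m α ψ q : ℝ) : ℝ :=
  (1 + Real.exp (α * (ψ * fermiE m q - m) / m))⁻¹

/-- Thomas–Fermi number density `n_F(ψ) = (g/2π²) ∫₀^∞ q² f(q,ψ) dq`. -/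
noncomputable def nF (m α g ψ : ℝ) : ℝ :=
  g / (2 * π ^ 2) * ∫ q in Ioi (0:ℝ), q ^ 2 * fermiF m α ψ q

/-- Thomas–Fermi energy density `ρ_F(ψ) = (g/2π²) ∫₀^∞ q² E(q) f(q,ψ) dq`. -/
noncomputable def rhoF (m α g ψ : ℝ) : ℝ :=
  g / (2 * π ^ 2) * ∫ q in Ioi (0:ℝ), q ^ 2 * fermiE m q * fermiF m α ψ q

/-- Thomas–Fermi pressure `p_F(ψ) = (g/6π²) ∫₀^∞ (q⁴/E(q)) f(q,ψ) dq`. -/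
noncomputable def pF (m α g ψ : ℝ) : ℝ :=
  g / (6 * π ^ 2) * ∫ q in Ioi (0:ℝ), q ^ 4 / fermiE m q * fermiF m α ψ q

theorem fermiE_pos {m : ℝ} (hm : 0 < m) (q : ℝ) : 0 < fermiE m q :=
  Real.sqrt_pos.2 (by positivity)

theorem le_fermiE (m q : ℝ) : q ≤ fermiE m q :=
  Real.le_sqrt_of_sq_le (by nlinarith [sq_nonneg m])

theorem fermiE_le {m q : ℝ} (hm : 0 < m) (hq : 0 < q) : fermiE m q ≤ m + q :=
  Real.sqrt_le_iff.2 ⟨by positivity, by nlinarith [mul_pos hm hq]⟩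

theorem continuous_fermiE (m : ℝ) : Continuous (fermiE m) := by
  unfold fermiE
  fun_prop

theorem hasDerivAt_fermiE {m : ℝ} (hm : 0 < m) (q : ℝ) :
    HasDerivAt (fermiE m) (q / fermiE m q) q := by
  have h := (((hasDerivAt_id q).pow 2).const_add (m ^ 2)).sqrt
    (show m ^ 2 + id q ^ 2 ≠ 0 by simp only [id]; positivity)
  refine h.congr_deriv ?_
  have hE := (fermiE_pos hm q).ne'
  simp only [fermiE, id, Pi.pow_apply] at hE ⊢
  field_simp
  norm_num

theorem fermiF_pos (m α ψ q : ℝ) : 0 < fermiF m α ψ q := by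
  unfold fermiF
  positivity

theorem fermiF_lt_one (m α ψ q : ℝ) : fermiF m α ψ q < 1 :=
  inv_lt_one_of_one_lt₀ (by linarith [Real.exp_pos (α * (ψ * fermiE m q - m) / m)])

theorem continuous_fermiF (m α ψ : ℝ) : Continuous (fermiF m α ψ) := by
  have := continuous_fermiE m
  unfold fermiF
  exact Continuous.inv₀ (by fun_prop) fun q => by positivity

/-- The chain rule for the logistic factor: `f' = -f (1 - f) u'`. -/
theorem hasDerivAt_inv_one_add_exp {u : ℝ → ℝ} {u' x : ℝ} (hu : HasDerivAt u u' x) :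
    HasDerivAt (fun y => (1 + Real.exp (u y))⁻¹)
      (-(u' * ((1 + Real.exp (u x))⁻¹ * (1 - (1 + Real.exp (u x))⁻¹)))) x := by
  have hX : 1 + Real.exp (u x) ≠ 0 := by positivity
  refine ((hu.exp.const_add 1).fun_inv hX).congr_deriv ?_
  field_simp
  ring

theorem hasDerivAt_fermiF_left (m α ψ q : ℝ) :
    HasDerivAt (fun ψ => fermiF m α ψ q)
      (-(α * fermiE m q / m * (fermiF m α ψ q * (1 - fermiF m α ψ q)))) ψ := by
  have hu : HasDerivAt (fun ψ => α * (ψ * fermiE m q - m) / m) (α * fermiE m q / m) ψ := by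
    simpa using
      ((((hasDerivAt_id ψ).mul_const (fermiE m q)).sub_const m).const_mul α).div_const m
  exact hasDerivAt_inv_one_add_exp hu

theorem hasDerivAt_fermiF {m : ℝ} (hm : 0 < m) (α ψ q : ℝ) :
    HasDerivAt (fermiF m α ψ)
      (-(α * (ψ * (q / fermiE m q)) / m * (fermiF m α ψ q * (1 - fermiF m α ψ q)))) q :=
  hasDerivAt_inv_one_add_exp
    (((((hasDerivAt_fermiE hm q).const_mul ψ).sub_const m).const_mul α).div_const m)

theorem fermiF_le_exp {m α ψ₀ ψ q : ℝ} (hm : 0 < m) (hα : 0 < α) (hψ₀ : 0 < ψ₀)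
    (hψ : ψ₀ ≤ ψ) (hq : 0 < q) :
    fermiF m α ψ q ≤ Real.exp α * Real.exp (-(α * ψ₀ / m) * q) := by
  have h1 : fermiF m α ψ q ≤ (Real.exp (α * (ψ * fermiE m q - m) / m))⁻¹ :=
    inv_anti₀ (Real.exp_pos _) (by linarith)
  refine h1.trans ?_
  rw [← Real.exp_neg, ← Real.exp_add, Real.exp_le_exp]
  have h2 : ψ₀ * q ≤ ψ * fermiE m q :=
    mul_le_mul hψ (le_fermiE m q) hq.le (hψ₀.le.trans hψ)
  have h3 : α / m * (ψ₀ * q) ≤ α / m * (ψ * fermiE m q) := by gcongr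
  have h4 : -(α * (ψ * fermiE m q - m) / m) = α - α / m * (ψ * fermiE m q) := by
    field_simp
    ring
  rw [h4]
  have h5 : -(α * ψ₀ / m) * q = -(α / m * (ψ₀ * q)) := by ring
  linarith

theorem integrableOn_pow_mul_exp_neg_mul (n : ℕ) {c : ℝ} (hc : 0 < c) :
    IntegrableOn (fun q : ℝ => q ^ n * Real.exp (-c * q)) (Ioi 0) := by
  have h := integrableOn_rpow_mul_exp_neg_mul_rpow (p := 1) (s := n) (b := c)
    (by have : (0 : ℝ) ≤ n := n.cast_nonneg
        linarith) one_pos hc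
  simpa using h

theorem integrableOn_add_pow_mul_exp_neg_mul (a : ℝ) (n : ℕ) {c : ℝ} (hc : 0 < c) :
    IntegrableOn (fun q : ℝ => (a + q) ^ n * Real.exp (-c * q)) (Ioi 0) := by
  simp_rw [add_pow, Finset.sum_mul]
  refine integrable_finsetSum _ fun k _ => ?_
  refine ((integrableOn_pow_mul_exp_neg_mul (n - k) hc).const_mul (a ^ k * n.choose k)).congr
    (Filter.Eventually.of_forall fun q => ?_)
  simp only
  ring

theorem integrableOn_mul_fermiF {m α ψ : ℝ} (hm : 0 < m) (hα : 0 < α) (hψ : 0 < ψ)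
    {w : ℝ → ℝ} (hw : Continuous w) (hb : ∀ q, 0 < q → |w q| ≤ (1 + m + q) ^ 4) :
    IntegrableOn (fun q => w q * fermiF m α ψ q) (Ioi 0) := by
  refine ((integrableOn_add_pow_mul_exp_neg_mul (1 + m) 4
    (show 0 < α * ψ / m by positivity)).const_mul (Real.exp α)).mono'
    (hw.mul (continuous_fermiF m α ψ)).aestronglyMeasurable ?_
  filter_upwards [ae_restrict_mem measurableSet_Ioi] with q hq
  have hq : 0 < q := hq
  rw [Real.norm_eq_abs, abs_mul, abs_of_pos (fermiF_pos m α ψ q)]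
  calc |w q| * fermiF m α ψ q
      ≤ (1 + m + q) ^ 4 * (Real.exp α * Real.exp (-(α * ψ / m) * q)) :=
        mul_le_mul (hb q hq) (fermiF_le_exp hm hα hψ le_rfl hq) (fermiF_pos _ _ _ _).le
          (by positivity)
    _ = _ := by ring

theorem continuous_pow_div_fermiE {m : ℝ} (hm : 0 < m) (n : ℕ) :
    Continuous fun q => q ^ n / fermiE m q :=
  (continuous_pow n).div (continuous_fermiE m) fun q => (fermiE_pos hm q).ne'

theorem integrableOn_pressure {m α ψ : ℝ} (hm : 0 < m) (hα : 0 < α) (hψ : 0 < ψ) :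
    IntegrableOn (fun q => q ^ 4 / fermiE m q * fermiF m α ψ q) (Ioi 0) := by
  refine integrableOn_mul_fermiF hm hα hψ (continuous_pow_div_fermiE hm 4) fun q hq => ?_
  have hE := fermiE_pos hm q
  rw [abs_of_nonneg (by positivity), div_le_iff₀ hE]
  calc q ^ 4 = q ^ 3 * q := by ring
    _ ≤ (1 + m + q) ^ 4 * fermiE m q := by
      refine mul_le_mul ?_ (le_fermiE m q) hq.le (by positivity)
      calc q ^ 3 ≤ (1 + m + q) ^ 3 := by gcongr; linarith
        _ ≤ (1 + m + q) ^ 4 := pow_le_pow_right₀ (by linarith) (by norm_num)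

theorem integrableOn_pow_mul_fermiE_mul_fermiF {m α ψ : ℝ} (hm : 0 < m) (hα : 0 < α)
    (hψ : 0 < ψ) {n : ℕ} (hn : n ≤ 3) :
    IntegrableOn (fun q => q ^ n * fermiE m q * fermiF m α ψ q) (Ioi 0) := by
  refine integrableOn_mul_fermiF hm hα hψ ((continuous_pow n).mul (continuous_fermiE m))
    fun q hq => ?_
  have hE := fermiE_pos hm q
  rw [abs_of_nonneg (by positivity)]
  calc q ^ n * fermiE m q ≤ (1 + m + q) ^ n * (1 + m + q) := by
        gcongr
        · linarith
        · linarith [fermiE_le hm hq]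
    _ = (1 + m + q) ^ (n + 1) := by ring
    _ ≤ (1 + m + q) ^ 4 := pow_le_pow_right₀ (by linarith) (by omega)

/-- Differentiation of the pressure integral under the integral sign. -/
theorem hasDerivAt_integral_pressure {m α ψ : ℝ} (hm : 0 < m) (hα : 0 < α) (hψ : 0 < ψ) :
    IntegrableOn
      (fun q => -(α / m * q ^ 4 * (fermiF m α ψ q * (1 - fermiF m α ψ q)))) (Ioi 0) ∧
    HasDerivAt (fun ψ => ∫ q in Ioi (0 : ℝ), q ^ 4 / fermiE m q * fermiF m α ψ q)
      (∫ q in Ioi (0 : ℝ), -(α / m * q ^ 4 * (fermiF m α ψ q * (1 - fermiF m α ψ q)))) ψ := by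
  have hcont (ψ : ℝ) := continuous_fermiF m α ψ
  refine hasDerivAt_integral_of_dominated_loc_of_deriv_le
    (F := fun ψ q => q ^ 4 / fermiE m q * fermiF m α ψ q)
    (F' := fun ψ q => -(α / m * q ^ 4 * (fermiF m α ψ q * (1 - fermiF m α ψ q))))
    (bound := fun q => α / m * Real.exp α * (q ^ 4 * Real.exp (-(α * (ψ / 2) / m) * q)))
    (Ici_mem_nhds (half_lt_self hψ)) (Filter.Eventually.of_forall fun ψ' => ?_)
    (integrableOn_pressure hm hα hψ) ?_ ?_ ?_ ?_
  · exact ((continuous_pow_div_fermiE hm 4).mul (hcont ψ')).aestronglyMeasurable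
  · exact Continuous.aestronglyMeasurable (by fun_prop)
  · filter_upwards [ae_restrict_mem measurableSet_Ioi] with q hq ψ' hψ'
    have hf := fermiF_pos m α ψ' q
    have hf1 := fermiF_lt_one m α ψ' q
    have hle := fermiF_le_exp hm hα (half_pos hψ) hψ' hq
    have h1 : fermiF m α ψ' q * (1 - fermiF m α ψ' q) ≤ fermiF m α ψ' q := by nlinarith
    have h0 : 0 ≤ fermiF m α ψ' q * (1 - fermiF m α ψ' q) := mul_nonneg hf.le (by linarith)
    rw [norm_neg, Real.norm_of_nonneg (by positivity)]
    calc _ ≤ α / m * q ^ 4 * (Real.exp α * Real.exp (-(α * (ψ / 2) / m) * q)) := by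
          exact mul_le_mul_of_nonneg_left (h1.trans hle) (by positivity)
      _ = _ := by ring
  · exact (integrableOn_pow_mul_exp_neg_mul 4 (by positivity)).const_mul _
  · refine Filter.Eventually.of_forall fun q ψ' _ => ?_
    refine ((hasDerivAt_fermiF_left m α ψ' q).const_mul (q ^ 4 / fermiE m q)).congr_deriv ?_
    have hE := (fermiE_pos hm q).ne'
    field_simp

/-- The derivative in `q` of the boundary term `q³ E(q) f(q,ψ)` of the integration by parts. -/
theorem hasDerivAt_pow_three_mul_fermiE_mul_fermiF {m : ℝ} (hm : 0 < m) (α ψ q : ℝ) :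
    HasDerivAt (fun q => q ^ 3 * fermiE m q * fermiF m α ψ q)
      (3 * (q ^ 2 * fermiE m q * fermiF m α ψ q) + q ^ 4 / fermiE m q * fermiF m α ψ q +
        ψ * -(α / m * q ^ 4 * (fermiF m α ψ q * (1 - fermiF m α ψ q)))) q := by
  refine (((hasDerivAt_pow 3 q).mul (hasDerivAt_fermiE hm q)).mul
    (hasDerivAt_fermiF hm α ψ q)).congr_deriv ?_
  have hE := (fermiE_pos hm q).ne'
  simp only [Pi.mul_apply]
  field_simp
  push_cast
  ring

/-- Consistency of the Fermi-gas equation of state with the equation of hydrostatic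
equilibrium and the Gibbs–Duhem relation: `ψ p_F'(ψ) = -(p_F(ψ) + ρ_F(ψ))`. -/
theorem thomas_fermi_eos_hydrostatic_identity
    (m α g : ℝ) (hm : 0 < m) (hα : 0 < α) (hg : 0 < g)
    (ψ : ℝ) (hψ : 0 < ψ) :
    ψ * deriv (pF m α g) ψ = -(pF m α g ψ + rhoF m α g ψ) := by
  obtain ⟨hW, hderiv⟩ := hasDerivAt_integral_pressure hm hα hψ
  have hp := integrableOn_pressure hm hα hψ
  have hρ := integrableOn_pow_mul_fermiE_mul_fermiF hm hα hψ (n := 2) (by norm_num)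
  have hG := integrableOn_pow_mul_fermiE_mul_fermiF hm hα hψ (n := 3) le_rfl
  have hdG (q : ℝ) := hasDerivAt_pow_three_mul_fermiE_mul_fermiF hm α ψ q
  have hsum := (hρ.const_mul 3).fun_add hp
  have hG' := hsum.fun_add (hW.const_mul ψ)
  have hlim := tendsto_zero_of_hasDerivAt_of_integrableOn_Ioi (fun q _ => hdG q) hG' hG
  have hparts := integral_Ioi_of_hasDerivAt_of_tendsto' (a := 0) (fun q _ => hdG q) hG' hlim
  rw [integral_add hsum (hW.const_mul ψ), integral_add (hρ.const_mul 3) hp,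
    integral_const_mul, integral_const_mul] at hparts
  have hpF : HasDerivAt (pF m α g) _ ψ := hderiv.const_mul (g / (6 * π ^ 2))
  rw [hpF.deriv, pF, rhoF]
  linear_combination (g / (6 * π ^ 2)) * hparts
end

section
/- For parameters $m > 0$, $\alpha > 0$, $g > 0$, the high-density limit of the number density holds: $\lim_{\psi \to 0^+} \psi^3\, n_F(\psi) = \dfrac{g\, m^3}{2\pi^2} \int_0^\infty \dfrac{x^2}{1 + e^{\alpha(x-1)}}\, dx$. -/
open Set Real MeasureTheory

theorem mul_fermiE_div (m : ℝ) {ψ : ℝ} (hm : 0 < m) (hψ : 0 < ψ) (x : ℝ) :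
    ψ * fermiE m (m / ψ * x) = m * √(ψ ^ 2 + x ^ 2) := by
  rw [fermiE, ← Real.sqrt_sq hψ.le, ← Real.sqrt_mul (sq_nonneg ψ), Real.sqrt_sq hψ.le]
  conv_rhs => rw [← Real.sqrt_sq hm.le, ← Real.sqrt_mul (sq_nonneg m)]
  congr 1
  field_simp

/-- The number-density integral in the rescaled momentum `x = ψ q / m`. -/
theorem cube_mul_nF {m α g ψ : ℝ} (hm : 0 < m) (hψ : 0 < ψ) :
    ψ ^ 3 * nF m α g ψ = g * m ^ 3 / (2 * π ^ 2) *
      ∫ x in Ioi (0 : ℝ), x ^ 2 / (1 + Real.exp (α * (√(ψ ^ 2 + x ^ 2) - 1))) := by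
  have hscale := integral_comp_mul_left_Ioi (fun q => q ^ 2 * fermiF m α ψ q) 0 (div_pos hm hψ)
  have hpt (x : ℝ) : (m / ψ * x) ^ 2 * fermiF m α ψ (m / ψ * x) =
      (m / ψ) ^ 2 * (x ^ 2 / (1 + Real.exp (α * (√(ψ ^ 2 + x ^ 2) - 1)))) := by
    have harg : α * (m * √(ψ ^ 2 + x ^ 2) - m) / m = α * (√(ψ ^ 2 + x ^ 2) - 1) := by
      field_simp
    rw [fermiF, mul_fermiE_div m hm hψ, harg]
    ring
  simp only [hpt, mul_zero, smul_eq_mul, integral_const_mul] at hscale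
  rw [inv_mul_eq_div, eq_div_iff (div_pos hm hψ).ne'] at hscale
  rw [nF, ← hscale]
  field_simp

theorem integrableOn_sq_mul_exp_neg {α : ℝ} (hα : 0 < α) :
    IntegrableOn (fun x : ℝ => x ^ 2 * Real.exp (-(α * (x - 1)))) (Ioi 0) := by
  have h := (integrableOn_rpow_mul_exp_neg_mul_rpow (p := 1) (s := 2) (by norm_num)
    one_pos hα).mul_const (Real.exp α)
  refine IntegrableOn.congr_fun h (fun x _ => ?_) measurableSet_Ioi
  simp only [Real.rpow_one, Real.rpow_two, mul_assoc, ← Real.exp_add]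
  ring_nf

/-- High-density limit of the number density:
`ψ³ n_F(ψ) → (g m³/2π²) ∫₀^∞ x²/(1+e^{α(x-1)}) dx` as `ψ → 0⁺`. -/
theorem thomas_fermi_high_density_number
    (m α g : ℝ) (hm : 0 < m) (hα : 0 < α) (hg : 0 < g) :
    Filter.Tendsto (fun ψ => ψ ^ 3 * nF m α g ψ) (nhdsWithin 0 (Ioi 0))
      (nhds (g * m ^ 3 / (2 * π ^ 2) *
        ∫ x in Ioi (0:ℝ), x ^ 2 / (1 + Real.exp (α * (x - 1))))) := by
  have hlim : Filter.Tendsto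
      (fun ψ : ℝ => ∫ x in Ioi (0 : ℝ), x ^ 2 / (1 + Real.exp (α * (√(ψ ^ 2 + x ^ 2) - 1))))
      (nhdsWithin 0 (Ioi 0))
      (nhds (∫ x in Ioi (0 : ℝ), x ^ 2 / (1 + Real.exp (α * (x - 1))))) := by
    have hcont : Continuous fun p : ℝ × ℝ =>
        p.2 ^ 2 / (1 + Real.exp (α * (√(p.1 ^ 2 + p.2 ^ 2) - 1))) :=
      Continuous.div (by fun_prop) (by fun_prop) fun p => by positivity
    refine tendsto_integral_filter_of_dominated_convergence
      (fun x => x ^ 2 * Real.exp (-(α * (x - 1)))) (.of_forall fun ψ => ?_)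
      (.of_forall fun ψ => ?_) (integrableOn_sq_mul_exp_neg hα) ?_
    · exact (hcont.comp (Continuous.prodMk_right ψ)).aestronglyMeasurable
    · refine .of_forall fun x => ?_
      rw [Real.norm_of_nonneg (by positivity), div_eq_mul_inv, Real.exp_neg]
      have hx : x ≤ √(ψ ^ 2 + x ^ 2) := Real.le_sqrt_of_sq_le (by nlinarith [sq_nonneg ψ])
      have hexp : Real.exp (α * (x - 1)) ≤ Real.exp (α * (√(ψ ^ 2 + x ^ 2) - 1)) := by gcongr
      gcongr
      linarith
    · filter_upwards [ae_restrict_mem measurableSet_Ioi] with x hx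
      have h := (hcont.comp (Continuous.prodMk_left x)).tendsto 0
      simp only [Function.comp_apply, ne_eq, OfNat.ofNat_ne_zero, not_false_eq_true, zero_pow,
        zero_add, Real.sqrt_sq (le_of_lt (mem_Ioi.mp hx))] at h
      exact h.mono_left nhdsWithin_le_nhds
  refine (hlim.const_mul _).congr' ?_
  filter_upwards [self_mem_nhdsWithin] with ψ hψ
  exact (cube_mul_nF hm hψ).symm
end

section
/- For parameters $m > 0$, $\alpha > 0$, $g > 0$, the equation of state obeys a $\gamma$-law with $\gamma = 4/3$ asymptotically at high densities: $\lim_{\psi \to 0^+} \dfrac{\rho_F(\psi)}{n_F(\psi)^{4/3}} = \left(\dfrac{g\,m^4}{2\pi^2}\int_0^\infty \dfrac{x^3\,dx}{1+e^{\alpha(x-1)}}\right) \cdot \left(\dfrac{g\,m^3}{2\pi^2}\int_0^\infty \dfrac{x^2\,dx}{1+e^{\alpha(x-1)}}\right)^{-4/3}$, a finite positive constant. -/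
open Set Real MeasureTheory

/-- The moment `∫₀^∞ xⁱ yʲ / (1 + exp(α(y - 1))) dx`, with `y = √(ψ² + x²)`, of the Fermi
distribution in the rescaled momentum `x = ψq/m`. -/
noncomputable def fermiMoment (α : ℝ) (i j : ℕ) (ψ : ℝ) : ℝ :=
  ∫ x in Ioi (0:ℝ), x ^ i * √(ψ ^ 2 + x ^ 2) ^ j / (1 + Real.exp (α * (√(ψ ^ 2 + x ^ 2) - 1)))

theorem pow_div_one_add_exp_le {α : ℝ} (hα : 0 < α) (n : ℕ) {y : ℝ} (hy : 0 ≤ y) :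
    y ^ n / (1 + Real.exp (α * (y - 1))) ≤
      n.factorial * (2 / α) ^ n * Real.exp α * Real.exp (-(α / 2) * y) := by
  have hpow : y ^ n ≤ n.factorial * (2 / α) ^ n * Real.exp (α / 2 * y) := by
    have h := Real.pow_div_factorial_le_exp (α / 2 * y) (by positivity) n
    have hf : (0:ℝ) < n.factorial := by positivity
    rw [div_le_iff₀ hf] at h
    calc y ^ n = (2 / α) ^ n * (α / 2 * y) ^ n := by
          rw [← mul_pow]; congr 1; field_simp
      _ ≤ (2 / α) ^ n * (Real.exp (α / 2 * y) * n.factorial) := by gcongr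
      _ = _ := by ring
  calc y ^ n / (1 + Real.exp (α * (y - 1)))
      ≤ (n.factorial * (2 / α) ^ n * Real.exp (α / 2 * y)) / Real.exp (α * (y - 1)) := by
        gcongr; linarith
    _ = n.factorial * (2 / α) ^ n * (Real.exp (α / 2 * y) / Real.exp (α * (y - 1))) := by ring
    _ = _ := by
        rw [← Real.exp_sub, mul_assoc _ (Real.exp α), ← Real.exp_add]
        congr 2; ring

theorem fermiMoment_integrand_le {α : ℝ} (hα : 0 < α) (i j : ℕ) (ψ : ℝ) {x : ℝ} (hx : 0 ≤ x) :
    x ^ i * √(ψ ^ 2 + x ^ 2) ^ j / (1 + Real.exp (α * (√(ψ ^ 2 + x ^ 2) - 1))) ≤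
      (i + j).factorial * (2 / α) ^ (i + j) * Real.exp α * Real.exp (-(α / 2) * x) := by
  have hxy : x ≤ √(ψ ^ 2 + x ^ 2) := Real.le_sqrt_of_sq_le (by nlinarith [sq_nonneg ψ])
  calc _ ≤ √(ψ ^ 2 + x ^ 2) ^ (i + j) / (1 + Real.exp (α * (√(ψ ^ 2 + x ^ 2) - 1))) := by
        rw [pow_add]; gcongr
    _ ≤ _ := pow_div_one_add_exp_le hα (i + j) (Real.sqrt_nonneg _)
    _ ≤ _ := by
        gcongr _ * Real.exp ?_
        nlinarith

theorem measurable_fermiMoment_integrand (α : ℝ) (i j : ℕ) (ψ : ℝ) :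
    Measurable fun x : ℝ =>
      x ^ i * √(ψ ^ 2 + x ^ 2) ^ j / (1 + Real.exp (α * (√(ψ ^ 2 + x ^ 2) - 1))) := by
  fun_prop

theorem integrableOn_fermiMoment_bound {α : ℝ} (hα : 0 < α) (n : ℕ) :
    IntegrableOn (fun x : ℝ =>
      n.factorial * (2 / α) ^ n * Real.exp α * Real.exp (-(α / 2) * x)) (Ioi 0) :=
  (exp_neg_integrableOn_Ioi 0 (half_pos hα)).const_mul _

theorem fermiMoment_zero (α : ℝ) (i j : ℕ) :
    fermiMoment α i j 0 = ∫ x in Ioi (0:ℝ), x ^ (i + j) / (1 + Real.exp (α * (x - 1))) := by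
  refine setIntegral_congr_fun measurableSet_Ioi fun x hx => ?_
  have h : √((0:ℝ) ^ 2 + x ^ 2) = x := by
    rw [zero_pow two_ne_zero, zero_add, Real.sqrt_sq (le_of_lt hx)]
  simp only [h, pow_add]

theorem fermiMoment_pos {α : ℝ} (hα : 0 < α) (i j : ℕ) (ψ : ℝ) : 0 < fermiMoment α i j ψ := by
  have hpos : ∀ x ∈ Ioi (0:ℝ),
      0 < x ^ i * √(ψ ^ 2 + x ^ 2) ^ j / (1 + Real.exp (α * (√(ψ ^ 2 + x ^ 2) - 1))) := by
    intro x hx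
    have hx : 0 < x := hx
    positivity
  have hint : IntegrableOn (fun x : ℝ =>
      x ^ i * √(ψ ^ 2 + x ^ 2) ^ j / (1 + Real.exp (α * (√(ψ ^ 2 + x ^ 2) - 1)))) (Ioi 0) := by
    refine (integrableOn_fermiMoment_bound hα (i + j)).mono'
      (measurable_fermiMoment_integrand α i j ψ).aestronglyMeasurable
      ((ae_restrict_mem measurableSet_Ioi).mono fun x hx => ?_)
    rw [Real.norm_of_nonneg (hpos x hx).le]
    exact fermiMoment_integrand_le hα i j ψ (le_of_lt hx)
  rw [fermiMoment, setIntegral_pos_iff_support_of_nonneg_ae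
    ((ae_restrict_mem measurableSet_Ioi).mono fun x hx => (hpos x hx).le) hint]
  rw [inter_eq_right.mpr fun x hx => Function.mem_support.mpr (hpos x hx).ne']
  simp

theorem continuous_fermiMoment {α : ℝ} (hα : 0 < α) (i j : ℕ) :
    Continuous (fermiMoment α i j) := by
  refine continuous_of_dominated
    (fun ψ => (measurable_fermiMoment_integrand α i j ψ).aestronglyMeasurable)
    (fun ψ => (ae_restrict_mem measurableSet_Ioi).mono fun x hx => ?_)
    (integrableOn_fermiMoment_bound hα (i + j)) (.of_forall fun x => ?_)
  · have hx : 0 < x := hx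
    rw [Real.norm_of_nonneg (by positivity)]
    exact fermiMoment_integrand_le hα i j ψ hx.le
  · exact Continuous.div (by fun_prop) (by fun_prop) fun ψ => by positivity

theorem integral_fermiF_eq_fermiMoment {m ψ : ℝ} (hm : 0 < m) (hψ : 0 < ψ) (α : ℝ) (i j : ℕ) :
    ∫ q in Ioi (0:ℝ), q ^ i * fermiE m q ^ j * fermiF m α ψ q =
      (m / ψ) ^ (i + j + 1) * fermiMoment α i j ψ := by
  have hc : 0 < m / ψ := div_pos hm hψ
  have hE : ∀ x, fermiE m (m / ψ * x) = m / ψ * √(ψ ^ 2 + x ^ 2) := fun x => by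
    rw [fermiE, ← Real.sqrt_sq hc.le, ← Real.sqrt_mul (sq_nonneg _), Real.sqrt_sq hc.le]
    congr 1
    field_simp
  have hsub := integral_comp_mul_left_Ioi
    (fun q => q ^ i * fermiE m q ^ j * fermiF m α ψ q) 0 hc
  rw [mul_zero, smul_eq_mul, eq_inv_mul_iff_mul_eq₀ hc.ne'] at hsub
  rw [← hsub, fermiMoment, pow_succ', mul_assoc]
  congr 1
  rw [← integral_const_mul]
  congr 1
  funext x
  have hexp : α * (ψ * (m / ψ * √(ψ ^ 2 + x ^ 2)) - m) / m = α * (√(ψ ^ 2 + x ^ 2) - 1) := by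
    field_simp
  rw [fermiF, hE, hexp, mul_pow, mul_pow, pow_add]
  ring

theorem nF_eq_fermiMoment {m ψ : ℝ} (hm : 0 < m) (hψ : 0 < ψ) (α g : ℝ) :
    nF m α g ψ = (1 / ψ) ^ 3 * (g * m ^ 3 / (2 * π ^ 2) * fermiMoment α 2 0 ψ) := by
  have h := integral_fermiF_eq_fermiMoment hm hψ α 2 0
  simp only [pow_zero, mul_one] at h
  rw [nF, h]
  ring

theorem rhoF_eq_fermiMoment {m ψ : ℝ} (hm : 0 < m) (hψ : 0 < ψ) (α g : ℝ) :
    rhoF m α g ψ = (1 / ψ) ^ 4 * (g * m ^ 4 / (2 * π ^ 2) * fermiMoment α 2 1 ψ) := by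
  have h := integral_fermiF_eq_fermiMoment hm hψ α 2 1
  simp only [pow_one] at h
  rw [rhoF, h]
  ring

theorem rhoF_div_nF_rpow {m α g ψ : ℝ} (hm : 0 < m) (hα : 0 < α) (hg : 0 < g) (hψ : 0 < ψ) :
    rhoF m α g ψ / (nF m α g ψ) ^ ((4:ℝ)/3) =
      (g * m ^ 4 / (2 * π ^ 2) * fermiMoment α 2 1 ψ) *
        (g * m ^ 3 / (2 * π ^ 2) * fermiMoment α 2 0 ψ) ^ (-(4:ℝ)/3) := by
  have hA := fermiMoment_pos hα 2 0 ψ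
  have hpow : ((1 / ψ) ^ 3) ^ ((4:ℝ)/3) = (1 / ψ) ^ 4 := by
    rw [← Real.rpow_natCast_mul (by positivity), ← Real.rpow_natCast]
    norm_num
  rw [rhoF_eq_fermiMoment hm hψ, nF_eq_fermiMoment hm hψ,
    Real.mul_rpow (by positivity) (by positivity), hpow,
    mul_div_mul_left _ _ (by positivity), neg_div, Real.rpow_neg (by positivity), div_eq_mul_inv]

/-- At high densities the equation of state obeys a `γ`-law with `γ = 4/3`:
`ρ_F(ψ)/n_F(ψ)^{4/3}` tends, as `ψ → 0⁺`, to the finite positive constant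
`(gm⁴/2π² ∫ x³/(1+e^{α(x-1)}) dx) · (gm³/2π² ∫ x²/(1+e^{α(x-1)}) dx)^{-4/3}`. -/
theorem thomas_fermi_gamma_law
    (m α g : ℝ) (hm : 0 < m) (hα : 0 < α) (hg : 0 < g) :
    Filter.Tendsto (fun ψ => rhoF m α g ψ / (nF m α g ψ) ^ ((4:ℝ)/3))
      (nhdsWithin 0 (Ioi 0))
      (nhds ((g * m ^ 4 / (2 * π ^ 2) *
          ∫ x in Ioi (0:ℝ), x ^ 3 / (1 + Real.exp (α * (x - 1)))) *
        (g * m ^ 3 / (2 * π ^ 2) *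
          ∫ x in Ioi (0:ℝ), x ^ 2 / (1 + Real.exp (α * (x - 1)))) ^ (-(4:ℝ)/3))) ∧
    0 < (g * m ^ 4 / (2 * π ^ 2) *
          ∫ x in Ioi (0:ℝ), x ^ 3 / (1 + Real.exp (α * (x - 1)))) *
        (g * m ^ 3 / (2 * π ^ 2) *
          ∫ x in Ioi (0:ℝ), x ^ 2 / (1 + Real.exp (α * (x - 1)))) ^ (-(4:ℝ)/3) := by
  have h₃ := fermiMoment_zero α 2 1
  have h₂ := fermiMoment_zero α 2 0
  norm_num only at h₂ h₃
  rw [← h₂, ← h₃]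
  have hB := fermiMoment_pos hα 2 1 0
  have hA := fermiMoment_pos hα 2 0 0
  refine ⟨?_, by positivity⟩
  have hcont : ContinuousAt (fun ψ => (g * m ^ 4 / (2 * π ^ 2) * fermiMoment α 2 1 ψ) *
      (g * m ^ 3 / (2 * π ^ 2) * fermiMoment α 2 0 ψ) ^ (-(4:ℝ)/3)) 0 :=
    ((continuous_fermiMoment hα 2 1).continuousAt.const_mul _).mul
      (((continuous_fermiMoment hα 2 0).continuousAt.const_mul _).rpow_const
        (Or.inl (by positivity)))
  refine (hcont.tendsto.mono_left nhdsWithin_le_nhds).congr' ?_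
  filter_upwards [self_mem_nhdsWithin] with ψ hψ
  exact (rhoF_div_nF_rpow hm hα hg hψ).symm
end

section
/- Scaling property of the general-relativistic Thomas–Fermi equation. Let $A > 0$, $\alpha > 0$, $g > 0$, $m > 0$, $\mu_0 > 0$, $R > 0$. Suppose $\psi, \mathcal{M} : (0,R] \to \mathbb{R}$ are differentiable with $r - 2\mathcal{M}(r) > 0$, $\mathcal{M}(r) \to 0$ as $r \to 0^+$, and satisfy the Thomas–Fermi field equations $\psi'(r) = \psi(r)\,\dfrac{\mathcal{M}(r) + 4\pi r^3 p_F^{(m)}(\psi(r))}{r\,(r - 2\mathcal{M}(r))}$ and $\mathcal{M}'(r) = 4\pi r^2 \rho_F^{(m)}(\psi(r))$, the boundary condition $\psi(R) = \frac{m}{\mu_0}\bigl(1 - \frac{2\mathcal{M}(R)}{R}\bigr)^{1/2}$, and the particle number $N = \int_0^R 4\pi r^2 (1 - 2\mathcal{M}(r)/r)^{-1/2}\, n_F^{(m)}(\psi(r))\, dr$. Then the rescaled configuration $\tilde\psi(r) := \psi(r/A)$, $\tilde{\mathcal{M}}(r) := A\,\mathcal{M}(r/A)$ satisfies the same field equations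 on $(0,AR]$ with fermion mass $\tilde m = A^{-1/2} m$ (and the same $\alpha$, $g$), the boundary condition at radius $\tilde R = AR$ with $\tilde\mu_0 = A^{-1/2}\mu_0$, and has particle number $\tilde N = \int_0^{AR} 4\pi r^2 (1 - 2\tilde{\mathcal{M}}(r)/r)^{-1/2}\, n_F^{(\tilde m)}(\tilde\psi(r))\, dr = A^{3/2} N$. -/
open Set Real MeasureTheory

/-- Simultaneous rescaling of mass and momentum rescales the energy. -/
theorem fermiE_scale {c : ℝ} (hc : 0 < c) (m q : ℝ) :
    fermiE (c * m) (c * q) = c * fermiE m q := by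
  unfold fermiE
  rw [show (c * m) ^ 2 + (c * q) ^ 2 = c ^ 2 * (m ^ 2 + q ^ 2) by ring,
    Real.sqrt_mul (sq_nonneg c), Real.sqrt_sq hc.le]

/-- The Fermi factor is invariant under simultaneous rescaling of mass and momentum. -/
theorem fermiF_scale {c : ℝ} (hc : 0 < c) (m α ψ q : ℝ) :
    fermiF (c * m) α ψ (c * q) = fermiF m α ψ q := by
  unfold fermiF
  rw [fermiE_scale hc, show α * (ψ * (c * fermiE m q) - c * m) =
    c * (α * (ψ * fermiE m q - m)) by ring, mul_div_mul_left _ _ hc.ne']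

theorem integral_Ioi_zero_eq_scale {c : ℝ} (hc : 0 < c) (F : ℝ → ℝ) :
    ∫ q in Ioi (0 : ℝ), F q = c * ∫ q in Ioi (0 : ℝ), F (c * q) := by
  rw [integral_comp_mul_left_Ioi F 0 hc, mul_zero, smul_eq_mul, mul_inv_cancel_left₀ hc.ne']

theorem nF_scale {c : ℝ} (hc : 0 < c) (m α g ψ : ℝ) :
    nF (c * m) α g ψ = c ^ 3 * nF m α g ψ := by
  unfold nF
  rw [integral_Ioi_zero_eq_scale hc]
  simp only [fermiF_scale hc, mul_pow, mul_assoc, integral_const_mul]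
  ring

theorem rhoF_scale {c : ℝ} (hc : 0 < c) (m α g ψ : ℝ) :
    rhoF (c * m) α g ψ = c ^ 4 * rhoF m α g ψ := by
  unfold rhoF
  rw [integral_Ioi_zero_eq_scale hc]
  have h (q : ℝ) : (c * q) ^ 2 * fermiE (c * m) (c * q) * fermiF (c * m) α ψ (c * q) =
      c ^ 3 * (q ^ 2 * fermiE m q * fermiF m α ψ q) := by
    rw [fermiE_scale hc, fermiF_scale hc]
    ring
  simp only [h, integral_const_mul]
  ring

theorem pF_scale {c : ℝ} (hc : 0 < c) (m α g ψ : ℝ) :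
    pF (c * m) α g ψ = c ^ 4 * pF m α g ψ := by
  unfold pF
  rw [integral_Ioi_zero_eq_scale hc]
  have h (q : ℝ) : (c * q) ^ 4 / fermiE (c * m) (c * q) * fermiF (c * m) α ψ (c * q) =
      c ^ 3 * (q ^ 4 / fermiE m q * fermiF m α ψ q) := by
    rw [fermiE_scale hc, fermiF_scale hc,
      show (c * q) ^ 4 = c * (c ^ 3 * q ^ 4) by ring, mul_div_mul_left _ _ hc.ne']
    ring
  simp only [h, integral_const_mul]
  ring

/-- **Scaling property of the general-relativistic Thomas–Fermi equation.** If the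
configuration `{ψ(r), M(r)}` solves the Thomas–Fermi self-consistency equations with
parameters `m, α, g, μ₀` on a ball of radius `R` and particle number `N`, then the
rescaled configuration `{ψ̃(r) = ψ(r/A), M̃(r) = A·M(r/A)}` solves them on the ball
of radius `ÃR = A·R` with fermion mass `m̃ = A^{-1/2} m`, chemical potential at
infinity `μ̃₀ = A^{-1/2} μ₀`, and particle number `Ñ = A^{3/2} N`. -/
theorem thomas_fermi_scaling
    (A α g m μ0 R : ℝ) (hA : 0 < A) (hα : 0 < α) (hg : 0 < g)
    (hm : 0 < m) (hμ0 : 0 < μ0) (hR : 0 < R)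
    (ψ M : ℝ → ℝ) (N : ℝ)
    (hψd : ∀ r ∈ Ioc (0:ℝ) R, DifferentiableAt ℝ ψ r)
    (hMd : ∀ r ∈ Ioc (0:ℝ) R, DifferentiableAt ℝ M r)
    (hhoriz : ∀ r ∈ Ioc (0:ℝ) R, 0 < r - 2 * M r)
    (hM0 : Filter.Tendsto M (nhdsWithin 0 (Ioi 0)) (nhds 0))
    -- Einstein field equations with the Thomas–Fermi equation of state
    (hfield1 : ∀ r ∈ Ioc (0:ℝ) R,
      deriv ψ r = ψ r * (M r + 4 * π * r ^ 3 * pF m α g (ψ r))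
        / (r * (r - 2 * M r)))
    (hfield2 : ∀ r ∈ Ioc (0:ℝ) R,
      deriv M r = 4 * π * r ^ 2 * rhoF m α g (ψ r))
    -- Schwarzschild matching boundary condition
    (hbc : ψ R = m / μ0 * Real.sqrt (1 - 2 * M R / R))
    -- particle number
    (hN : N = ∫ r in (0:ℝ)..R,
      4 * π * r ^ 2 * (Real.sqrt (1 - 2 * M r / r))⁻¹ * nF m α g (ψ r)) :
    -- the rescaled configuration satisfies the field equations on (0, A·R] ...
    (∀ r ∈ Ioc (0:ℝ) (A * R),
      deriv (fun r' => ψ (r' / A)) r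
        = ψ (r / A) * (A * M (r / A)
            + 4 * π * r ^ 3 * pF (A ^ (-(1:ℝ)/2) * m) α g (ψ (r / A)))
          / (r * (r - 2 * (A * M (r / A))))) ∧
    (∀ r ∈ Ioc (0:ℝ) (A * R),
      deriv (fun r' => A * M (r' / A)) r
        = 4 * π * r ^ 2 * rhoF (A ^ (-(1:ℝ)/2) * m) α g (ψ (r / A))) ∧
    -- ... the boundary condition at radius ÃR = A·R with μ̃₀ = A^{-1/2} μ₀ ...
    ψ (A * R / A) = (A ^ (-(1:ℝ)/2) * m) / (A ^ (-(1:ℝ)/2) * μ0)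
        * Real.sqrt (1 - 2 * (A * M (A * R / A)) / (A * R)) ∧
    -- ... and has particle number Ñ = A^{3/2} N
    (∫ r in (0:ℝ)..(A * R),
        4 * π * r ^ 2 * (Real.sqrt (1 - 2 * (A * M (r / A)) / r))⁻¹
          * nF (A ^ (-(1:ℝ)/2) * m) α g (ψ (r / A)))
      = A ^ ((3:ℝ)/2) * N := by
  have hA0 : A ≠ 0 := hA.ne'
  have hc : 0 < A ^ (-(1 : ℝ) / 2) := Real.rpow_pos_of_pos hA _
  have hc2 : (A ^ (-(1 : ℝ) / 2)) ^ 2 = A⁻¹ := by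
    rw [← Real.rpow_natCast, ← Real.rpow_mul hA.le, ← Real.rpow_neg_one]
    norm_num
  have hc4 : (A ^ (-(1 : ℝ) / 2)) ^ 4 = (A ^ 2)⁻¹ := by
    rw [show (4 : ℕ) = 2 * 2 by norm_num, pow_mul, hc2, inv_pow]
  have hc3 : A ^ ((3 : ℝ) / 2) = A ^ 3 * (A ^ (-(1 : ℝ) / 2)) ^ 3 := by
    rw [← Real.rpow_natCast, ← Real.rpow_natCast, ← Real.rpow_mul hA.le, ← Real.rpow_add hA]
    norm_num
  have hmem : ∀ r ∈ Ioc (0 : ℝ) (A * R), r / A ∈ Ioc (0 : ℝ) R := fun r hr =>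
    ⟨div_pos hr.1 hA, (div_le_iff₀' hA).2 hr.2⟩
  have hcomp (f : ℝ → ℝ) (r : ℝ) (hf : DifferentiableAt ℝ f (r / A)) :
      HasDerivAt (fun r' => f (r' / A)) (deriv f (r / A) * (1 / A)) r :=
    hf.hasDerivAt.comp r ((hasDerivAt_id r).div_const A)
  refine ⟨fun r hr => ?_, fun r hr => ?_, ?_, ?_⟩
  · have hs := hmem r hr
    have hr0 : r ≠ 0 := hr.1.ne'
    have hh : r / A - 2 * M (r / A) ≠ 0 := (hhoriz _ hs).ne'
    have hh' : r - 2 * (A * M (r / A)) = A * (r / A - 2 * M (r / A)) := by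
      field_simp
    rw [(hcomp ψ r (hψd _ hs)).deriv, hfield1 _ hs, pF_scale hc, hc4, hh']
    generalize r / A - 2 * M (r / A) = d at *
    field_simp
  · have hs := hmem r hr
    rw [((hcomp M r (hMd _ hs)).const_mul A).deriv, hfield2 _ hs, rhoF_scale hc, hc4]
    field_simp
  · rw [mul_div_cancel_left₀ R hA0, hbc, mul_div_mul_left _ _ hc.ne',
      show 2 * (A * M R) = A * (2 * M R) by ring, mul_div_mul_left _ _ hA0]
  · have hint (r : ℝ) : 4 * π * r ^ 2 * (√(1 - 2 * (A * M (r / A)) / r))⁻¹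
          * nF (A ^ (-(1 : ℝ) / 2) * m) α g (ψ (r / A))
        = A ^ 2 * (A ^ (-(1 : ℝ) / 2)) ^ 3 * (4 * π * (r / A) ^ 2 *
          (√(1 - 2 * M (r / A) / (r / A)))⁻¹ * nF m α g (ψ (r / A))) := by
      rw [nF_scale hc, show 2 * (A * M (r / A)) / r = 2 * M (r / A) / (r / A) by
        rw [div_div_eq_mul_div]; ring]
      field_simp
    simp only [hint]
    rw [intervalIntegral.integral_const_mul,
      intervalIntegral.integral_comp_div (fun s => 4 * π * s ^ 2 *
        (√(1 - 2 * M s / s))⁻¹ * nF m α g (ψ s)) hA0,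
      zero_div, mul_div_cancel_left₀ R hA0, ← hN, hc3, smul_eq_mul]
    ring
end
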